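/- Fix d ≥ 1, T > 0, a compact interval Θ = [θ_min, θ_max] ⊂ (0,∞), a link function Φ, and a smooth ℤ^d-periodic initial value u_0. There exists a constant D > 0, depending only on d, T, Θ, Φ and u_0, such that: for every θ ∈ Θ and all continuous bounded ℤ^d-periodic F, h, if u_{θ,F} is a smooth classical solution with absorption Φ∘F, diffusivity θ and initial value u_0, and z_{θ,F,h} is the associated linearized solution in direction h, then ‖z_{θ,F,h}‖_{H^{2,1}(Q)} ≤ D (1 + ‖F‖_∞) ‖h‖_{L²(𝕋^d)} ‖u_{θ,F}‖_∞. (Lemma 'bounds', item (vii): parabolic regularity bound for the linearization I_{θ,F}h.) -/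

import Mathlib

open MeasureTheory Real Filter

noncomputable section

/-- Partial derivative in the `i`-th spatial coordinate. -/
def pder {d : ℕ} (i : Fin d) (v : (Fin d → ℝ) → ℝ) : (Fin d → ℝ) → ℝ :=
  fun x => deriv (fun s => v (Function.update x i s)) (x i)

/-- Spatial Laplacian `Δ_x = ∑ᵢ ∂²/∂xᵢ²`. -/
def lap {d : ℕ} (v : (Fin d → ℝ) → ℝ) : (Fin d → ℝ) → ℝ :=
  fun x => ∑ i : Fin d, pder i (pder i v) x

/-- Multi-index spatial derivative `∂^j`. -/
def mder {d : ℕ} (j : Fin d → ℕ) (v : (Fin d → ℝ) → ℝ) : (Fin d → ℝ) → ℝ :=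
  (List.finRange d).foldr (fun i acc => (pder i)^[j i] acc) v

/-- `ℤ^d`-periodicity of a function on `ℝ^d`. -/
def ZPer {d : ℕ} (F : (Fin d → ℝ) → ℝ) : Prop :=
  ∀ (x : Fin d → ℝ) (k : Fin d → ℤ), F (fun i => x i + (k i : ℝ)) = F x

/-- `ℤ^d`-periodicity in the space variable. -/
def ZPerSpace {d : ℕ} (u : (Fin d → ℝ) → ℝ → ℝ) : Prop :=
  ∀ t : ℝ, ZPer fun x => u x t

/-- The fundamental domain `[0,1]^d` of the torus. -/
def unitCube (d : ℕ) : Set (Fin d → ℝ) := Set.Icc 0 1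

/-- `L²`-norm on the torus. -/
def l2T {d : ℕ} (F : (Fin d → ℝ) → ℝ) : ℝ :=
  Real.sqrt (∫ x in unitCube d, (F x) ^ 2)

/-- `L²`-norm on `Q = 𝕋^d × (0,T)`. -/
def l2Q {d : ℕ} (T : ℝ) (u : (Fin d → ℝ) → ℝ → ℝ) : ℝ :=
  Real.sqrt (∫ t in Set.Ioc (0 : ℝ) T, ∫ x in unitCube d, (u x t) ^ 2)

/-- Supremum norm over space. -/
def supT {d : ℕ} (F : (Fin d → ℝ) → ℝ) : ℝ := ⨆ x, |F x|

/-- Supremum norm over `𝕋^d × [0,T]`. -/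
def supQ {d : ℕ} (T : ℝ) (u : (Fin d → ℝ) → ℝ → ℝ) : ℝ :=
  ⨆ x, ⨆ t ∈ Set.Icc (0 : ℝ) T, |u x t|

/-- Squared Sobolev `H^β`-norm on the torus:  `∑_{|j| ≤ β} ‖∂^j F‖²_{L²(𝕋^d)}`. -/
def hSobSq {d : ℕ} (β : ℕ) (F : (Fin d → ℝ) → ℝ) : ℝ :=
  ∑ j ∈ Finset.univ.filter (fun j : Fin d → Fin (β + 1) => (∑ i, (j i : ℕ)) ≤ β),
    ∫ x in unitCube d, (mder (fun i => (j i : ℕ)) F x) ^ 2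

/-- Sobolev `H^β`-norm on the torus. -/
def hSob {d : ℕ} (β : ℕ) (F : (Fin d → ℝ) → ℝ) : ℝ := Real.sqrt (hSobSq β F)

/-- Squared parabolic Sobolev `H^{2,1}(Q)`-norm. -/
def h21Sq {d : ℕ} (T : ℝ) (u : (Fin d → ℝ) → ℝ → ℝ) : ℝ :=
  (∫ t in Set.Ioc (0 : ℝ) T,
      ∑ j ∈ Finset.univ.filter (fun j : Fin d → Fin 3 => (∑ i, (j i : ℕ)) ≤ 2),
        ∫ x in unitCube d, (mder (fun i => (j i : ℕ)) (fun y => u y t) x) ^ 2)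
    + ∫ x in unitCube d, ∫ t in Set.Ioc (0 : ℝ) T, ((u x t) ^ 2 + (deriv (u x) t) ^ 2)

/-- Parabolic Sobolev `H^{2,1}(Q)`-norm. -/
def h21 {d : ℕ} (T : ℝ) (u : (Fin d → ℝ) → ℝ → ℝ) : ℝ := Real.sqrt (h21Sq T u)

/-- Smoothness of a function of space and time. -/
def SmoothQ {d : ℕ} (u : (Fin d → ℝ) → ℝ → ℝ) : Prop :=
  ContDiff ℝ (⊤ : ℕ∞) fun p : (Fin d → ℝ) × ℝ => u p.1 p.2

/-- A smooth classical solution of the heat equation with absorption `f`,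
diffusivity `θ` and initial value `u0`. -/
def HeatSol {d : ℕ} (T θ : ℝ) (f u0 : (Fin d → ℝ) → ℝ) (u : (Fin d → ℝ) → ℝ → ℝ) : Prop :=
  SmoothQ u ∧ ZPerSpace u ∧
    (∀ (x : Fin d → ℝ), ∀ t ∈ Set.Ioc (0 : ℝ) T,
      deriv (u x) t = θ / 2 * lap (fun y => u y t) x - f x * u x t) ∧
    ∀ x, u x 0 = u0 x

/-- A smooth solution of the inhomogeneous problem with forcing `g` and
zero initial value (`v = 𝓛_{θ,f}⁻¹ g`). -/
def InhomSol {d : ℕ} (T θ : ℝ) (f : (Fin d → ℝ) → ℝ) (g v : (Fin d → ℝ) → ℝ → ℝ) : Prop :=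
  SmoothQ v ∧ ZPerSpace v ∧
    (∀ (x : Fin d → ℝ), ∀ t ∈ Set.Ioc (0 : ℝ) T,
      deriv (v x) t = θ / 2 * lap (fun y => v y t) x - f x * v x t + g x t) ∧
    ∀ x, v x 0 = 0

/-- A link function: a smooth function `Φ : ℝ → (fmin, ∞)` with strictly positive
derivative and all derivatives bounded. -/
structure LinkFun where
  toFun : ℝ → ℝ
  fmin : ℝ
  fmin_pos : 0 < fmin
  smooth : ContDiff ℝ (⊤ : ℕ∞) toFun
  gt_fmin : ∀ x, fmin < toFun x
  deriv_pos : ∀ x, 0 < deriv toFun x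
  derivs_bdd : ∀ n : ℕ, 1 ≤ n → ∃ C, ∀ x, |iteratedDeriv n toFun x| ≤ C

/-- The linearized solution `I_{θ,F} h` in direction `h`, associated with a solution `u`. -/
def LinSol {d : ℕ} (T θ : ℝ) (Φ : LinkFun) (F h : (Fin d → ℝ) → ℝ)
    (u z : (Fin d → ℝ) → ℝ → ℝ) : Prop :=
  SmoothQ z ∧ ZPerSpace z ∧
    (∀ (x : Fin d → ℝ), ∀ t ∈ Set.Ioc (0 : ℝ) T,
      deriv (z x) t = θ / 2 * lap (fun y => z y t) x - Φ.toFun (F x) * z x t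
        + h x * deriv Φ.toFun (F x) * u x t) ∧
    ∀ x, z x 0 = 0

/-- The `θ`-derivative solution `K̇_θ F`, associated with a solution `u`. -/
def ThetaDerivSol {d : ℕ} (T θ : ℝ) (Φ : LinkFun) (F : (Fin d → ℝ) → ℝ)
    (u w : (Fin d → ℝ) → ℝ → ℝ) : Prop :=
  SmoothQ w ∧ ZPerSpace w ∧
    (∀ (x : Fin d → ℝ), ∀ t ∈ Set.Ioc (0 : ℝ) T,
      deriv (w x) t = θ / 2 * lap (fun y => w y t) x - Φ.toFun (F x) * w x t
        + 1 / 2 * lap (fun y => u y t) x) ∧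
    ∀ x, w x 0 = 0

/-- Dual Sobolev norm `‖G‖_{(H²)*}` on the torus. -/
def h2dual {d : ℕ} (G : (Fin d → ℝ) → ℝ) : ℝ :=
  sSup {r : ℝ | ∃ g : (Fin d → ℝ) → ℝ, ContDiff ℝ (⊤ : ℕ∞) g ∧ ZPer g ∧ hSob 2 g ≤ 1 ∧
    r = |∫ x in unitCube d, G x * g x|}

end

/-- The derivative of `W` in the fixed space-time direction `v`. -/
noncomputable def dirDeriv {d : ℕ} (v : (Fin d → ℝ) × ℝ) (W : (Fin d → ℝ) × ℝ → ℝ) :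
    (Fin d → ℝ) × ℝ → ℝ :=
  fun p => fderiv ℝ W p v

/-- The `i`-th spatial unit vector in space-time. -/
def spaceDir {d : ℕ} (i : Fin d) : (Fin d → ℝ) × ℝ := (Pi.single i 1, 0)

/-- The temporal unit vector in space-time. -/
def timeDir {d : ℕ} : (Fin d → ℝ) × ℝ := (0, 1)

/-- `ℤ^d`-periodicity in space of a function on space-time. -/
def SpacePeriodic {d : ℕ} (W : (Fin d → ℝ) × ℝ → ℝ) : Prop :=
  ∀ (p : (Fin d → ℝ) × ℝ) (k : Fin d → ℤ), W (p + (fun i => (k i : ℝ), 0)) = W p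

/-- Lebesgue measure on the parabolic cylinder `[0,1]^d × (0,T]`. -/
noncomputable def cylMeasure (d : ℕ) (T : ℝ) : Measure ((Fin d → ℝ) × ℝ) :=
  (volume.restrict (unitCube d)).prod (volume.restrict (Set.Ioc (0 : ℝ) T))

section Derivatives

variable {d : ℕ} {V W : (Fin d → ℝ) × ℝ → ℝ}

lemma ContDiff.dirDeriv (hW : ContDiff ℝ (⊤ : ℕ∞) W) (v : (Fin d → ℝ) × ℝ) :
    ContDiff ℝ (⊤ : ℕ∞) (dirDeriv v W) :=
  (hW.fderiv_right (m := (⊤ : ℕ∞)) (by simp)).clm_apply contDiff_const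

lemma SpacePeriodic.dirDeriv (hW : SpacePeriodic W) (v : (Fin d → ℝ) × ℝ) :
    SpacePeriodic (dirDeriv v W) := by
  intro p k
  have h : (fun q => W (q + (fun i => (k i : ℝ), 0))) = W := funext fun q => hW q k
  unfold _root_.dirDeriv
  rw [← fderiv_comp_add_right, h]

lemma dirDeriv_comm (hW : ContDiff ℝ (⊤ : ℕ∞) W) (v w : (Fin d → ℝ) × ℝ) :
    dirDeriv v (dirDeriv w W) = dirDeriv w (dirDeriv v W) := by
  have hd : Differentiable ℝ (fderiv ℝ W) :=
    (hW.fderiv_right (m := 1) (by norm_cast)).differentiable (by norm_num)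
  have h (a b p) : dirDeriv a (dirDeriv b W) p = fderiv ℝ (fderiv ℝ W) p a b := by
    unfold dirDeriv
    rw [fderiv_clm_apply (hd p) (differentiableAt_const b)]
    simp
  funext p
  rw [h, h]
  exact (hW.contDiffAt.isSymmSndFDerivAt (by
    rw [minSmoothness_of_isRCLikeNormedField]
    exact WithTop.coe_le_coe.mpr (le_top : (2 : ℕ∞) ≤ ⊤))) v w

lemma dirDeriv_mul (hV : ContDiff ℝ (⊤ : ℕ∞) V) (hW : ContDiff ℝ (⊤ : ℕ∞) W)
    (v p : (Fin d → ℝ) × ℝ) :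
    dirDeriv v (fun q => V q * W q) p = dirDeriv v V p * W p + V p * dirDeriv v W p := by
  unfold dirDeriv
  rw [fderiv_fun_mul (hV.differentiable (by simp) p) (hW.differentiable (by simp) p)]
  simp
  ring

lemma pder_slice (hW : ContDiff ℝ (⊤ : ℕ∞) W) (i : Fin d) (t : ℝ) :
    pder i (fun x => W (x, t)) = fun x => dirDeriv (spaceDir i) W (x, t) := by
  funext x
  have h1 : HasFDerivAt W (fderiv ℝ W (x, t)) (Function.update x i (x i), t) := by
    rw [Function.update_eq_self]
    exact (hW.differentiable (by simp) _).hasFDerivAt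
  exact (h1.comp_hasDerivAt (x i)
    ((hasDerivAt_update x i (x i)).prodMk (hasDerivAt_const (x i) t))).deriv

lemma hasDerivAt_time (hW : ContDiff ℝ (⊤ : ℕ∞) W) (x : Fin d → ℝ) (t : ℝ) :
    HasDerivAt (fun s => W (x, s)) (dirDeriv timeDir W (x, t)) t :=
  (hW.differentiable (by simp) (x, t)).hasFDerivAt.comp_hasDerivAt t
    ((hasDerivAt_const t x).prodMk (hasDerivAt_id t))

lemma lap_slice (hW : ContDiff ℝ (⊤ : ℕ∞) W) (x : Fin d → ℝ) (t : ℝ) :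
    lap (fun y => W (y, t)) x =
      ∑ i, dirDeriv (spaceDir i) (dirDeriv (spaceDir i) W) (x, t) := by
  refine Finset.sum_congr rfl fun i _ => ?_
  rw [pder_slice hW, pder_slice (hW.dirDeriv _)]

lemma exists_mder_eq_foldr (j : Fin d → ℕ) :
    ∃ L : List (Fin d), L.length = ∑ i, j i ∧ ∀ v, mder j v = L.foldr pder v := by
  have key (l : List (Fin d)) : ∃ L : List (Fin d), L.length = (l.map j).sum ∧
      ∀ v : (Fin d → ℝ) → ℝ,
        l.foldr (fun i acc => (pder i)^[j i] acc) v = L.foldr pder v := by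
    induction l with
    | nil => exact ⟨[], rfl, fun _ => rfl⟩
    | cons i l ih =>
      obtain ⟨L, hL, h⟩ := ih
      refine ⟨List.replicate (j i) i ++ L, by simp [hL], fun v => ?_⟩
      rw [List.foldr_cons, h, List.foldr_append]
      generalize L.foldr pder v = w
      induction j i with
      | zero => rfl
      | succ n ihn => rw [Function.iterate_succ_apply', ihn, List.replicate_succ, List.foldr_cons]
  obtain ⟨L, hL, h⟩ := key (List.finRange d)
  exact ⟨L, by rw [hL, Fin.sum_univ_def], h⟩

lemma mder_slice_sq_le (hW : ContDiff ℝ (⊤ : ℕ∞) W) {j : Fin d → ℕ} (hj : ∑ i, j i ≤ 2)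
    (x : Fin d → ℝ) (t : ℝ) :
    (mder j (fun y => W (y, t)) x) ^ 2 ≤ W (x, t) ^ 2
      + ∑ i, dirDeriv (spaceDir i) W (x, t) ^ 2
      + ∑ i, ∑ k, dirDeriv (spaceDir i) (dirDeriv (spaceDir k) W) (x, t) ^ 2 := by
  have h0 := sq_nonneg (W (x, t))
  have h1 : 0 ≤ ∑ i, dirDeriv (spaceDir i) W (x, t) ^ 2 :=
    Finset.sum_nonneg fun i _ => sq_nonneg _
  have h2 : 0 ≤ ∑ i, ∑ k, dirDeriv (spaceDir i) (dirDeriv (spaceDir k) W) (x, t) ^ 2 :=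
    Finset.sum_nonneg fun i _ => Finset.sum_nonneg fun k _ => sq_nonneg _
  obtain ⟨L, hL, h⟩ := exists_mder_eq_foldr j
  rw [h]
  match L with
  | [] => rw [List.foldr_nil]; linarith
  | [i] =>
    rw [List.foldr_cons, List.foldr_nil, pder_slice hW]
    have := Finset.single_le_sum (fun i _ => sq_nonneg (dirDeriv (spaceDir i) W (x, t)))
      (Finset.mem_univ i)
    linarith
  | [i, k] =>
    rw [List.foldr_cons, List.foldr_cons, List.foldr_nil, pder_slice hW,
      pder_slice (hW.dirDeriv _)]
    have e1 := Finset.single_le_sum (fun k _ => sq_nonneg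
      (dirDeriv (spaceDir i) (dirDeriv (spaceDir k) W) (x, t))) (Finset.mem_univ k)
    have e2 := Finset.single_le_sum (f := fun i => ∑ k,
      dirDeriv (spaceDir i) (dirDeriv (spaceDir k) W) (x, t) ^ 2)
      (fun i _ => Finset.sum_nonneg fun k _ => sq_nonneg _) (Finset.mem_univ i)
    linarith
  | _ :: _ :: _ :: _ => simp only [List.length_cons] at hL; omega

lemma continuous_mder_slice (hW : ContDiff ℝ (⊤ : ℕ∞) W) (j : Fin d → ℕ) :
    Continuous fun p : (Fin d → ℝ) × ℝ => mder j (fun y => W (y, p.2)) p.1 := by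
  have key (L : List (Fin d)) : ∃ V, ContDiff ℝ (⊤ : ℕ∞) V ∧
      ∀ t, L.foldr pder (fun y => W (y, t)) = fun y => V (y, t) := by
    induction L with
    | nil => exact ⟨W, hW, fun t => rfl⟩
    | cons i L ih =>
      obtain ⟨V, hV, h⟩ := ih
      refine ⟨_, hV.dirDeriv (spaceDir i), fun t => ?_⟩
      rw [List.foldr_cons, h, pder_slice hV]
  obtain ⟨L, -, hL⟩ := exists_mder_eq_foldr j
  obtain ⟨V, hV, h⟩ := key L
  simpa only [hL, h] using hV.continuous

end Derivatives

section Integrals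

variable {d : ℕ} {T : ℝ} {V W : (Fin d → ℝ) × ℝ → ℝ}

lemma Continuous.integrable_cylMeasure (hW : Continuous W) (T : ℝ) :
    Integrable W (cylMeasure d T) := by
  rw [cylMeasure, Measure.prod_restrict]
  have : IntegrableOn W (Set.Icc 0 1 ×ˢ Set.Icc 0 T) (volume.prod volume) :=
    hW.continuousOn.integrableOn_compact (isCompact_Icc.prod isCompact_Icc)
  exact this.mono_set (Set.prod_mono subset_rfl Set.Ioc_subset_Icc_self)

lemma ae_cylMeasure_mem_Ioc (d : ℕ) (T : ℝ) :
    ∀ᵐ p ∂cylMeasure d T, p.2 ∈ Set.Ioc (0 : ℝ) T := by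
  rw [cylMeasure, Measure.prod_restrict]
  filter_upwards [ae_restrict_mem (measurableSet_Icc.prod measurableSet_Ioc)] with p hp
  exact hp.2

/-- The partial derivatives of a periodic function have zero mean over the unit cube. -/
lemma setIntegral_unitCube_fderiv_single_eq_zero {v : (Fin d → ℝ) → ℝ} (hv : ContDiff ℝ 1 v)
    (hper : ZPer v) (i : Fin d) :
    ∫ x in unitCube d, fderiv ℝ v x (Pi.single i 1) = 0 := by
  obtain _ | n := d
  · exact i.elim0
  have hc : Continuous fun x => fderiv ℝ v x (Pi.single i 1) :=
    (hv.continuous_fderiv (by norm_num)).clm_apply continuous_const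
  have hsum (x : Fin (n + 1) → ℝ) :
      ∑ k, (if k = i then fderiv ℝ v x else 0) (Pi.single k 1) =
        fderiv ℝ v x (Pi.single i 1) := by
    rw [Finset.sum_eq_single i] <;> simp +contextual
  have key := integral_divergence_of_hasFDerivAt_off_countable' (0 : Fin (n + 1) → ℝ) 1
    zero_le_one (fun k x => if k = i then v x else 0)
    (fun k x => if k = i then fderiv ℝ v x else 0) ∅ Set.countable_empty
    (fun k => by split_ifs; exacts [hv.continuous.continuousOn, continuousOn_const])
    (fun x _ k => by
      split_ifs
      exacts [(hv.differentiable (by norm_num) x).hasFDerivAt, hasFDerivAt_const _ _])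
    (by simp only [hsum]; exact hc.continuousOn.integrableOn_compact isCompact_Icc)
  simp only [hsum] at key
  rw [unitCube, key]
  refine Finset.sum_eq_zero fun k _ => ?_
  rw [sub_eq_zero]
  congr 1
  funext y
  split_ifs
  · rw [← hper (k.insertNth ((0 : Fin (n + 1) → ℝ) k) y) (Pi.single k 1)]
    congr 1
    funext l
    refine Fin.succAboveCases k ?_ (fun m => ?_) l <;> simp
  · rfl

lemma integral_dirDeriv_spaceDir_eq_zero (hW : ContDiff ℝ (⊤ : ℕ∞) W) (hper : SpacePeriodic W)
    (i : Fin d) : ∫ p, dirDeriv (spaceDir i) W p ∂cylMeasure d T = 0 := by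
  have hi := (hW.dirDeriv (spaceDir i)).continuous.integrable_cylMeasure T
  rw [cylMeasure] at hi ⊢
  rw [integral_prod_symm _ hi]
  refine integral_eq_zero_of_ae (.of_forall fun t => ?_)
  have hs : ContDiff ℝ (⊤ : ℕ∞) fun x => W (x, t) := hW.comp (by fun_prop)
  have h := setIntegral_unitCube_fderiv_single_eq_zero (hs.of_le (by norm_cast))
    (fun x k => by simpa [Pi.add_def] using hper (x, t) k) i
  refine Eq.trans ?_ h
  refine integral_congr_ae (.of_forall fun x => ?_)
  have := (hW.differentiable (by simp) (x, t)).hasFDerivAt.comp (f := fun y => (y, t)) x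
    ((hasFDerivAt_id x).prodMk (hasFDerivAt_const t x))
  exact (DFunLike.congr_fun this.fderiv (Pi.single i 1)).symm

lemma integral_mul_dirDeriv_spaceDir (hV : ContDiff ℝ (⊤ : ℕ∞) V) (hW : ContDiff ℝ (⊤ : ℕ∞) W)
    (hVp : SpacePeriodic V) (hWp : SpacePeriodic W) (i : Fin d) :
    ∫ p, V p * dirDeriv (spaceDir i) W p ∂cylMeasure d T =
      -∫ p, dirDeriv (spaceDir i) V p * W p ∂cylMeasure d T := by
  have h := integral_dirDeriv_spaceDir_eq_zero (T := T) (W := fun p => V p * W p) (hV.mul hW)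
    (fun p k => by simp only [hVp p k, hWp p k]) i
  have e : dirDeriv (spaceDir i) (fun p => V p * W p) =
      fun p => dirDeriv (spaceDir i) V p * W p + V p * dirDeriv (spaceDir i) W p :=
    funext fun p => dirDeriv_mul hV hW _ p
  have h1 : Integrable (fun p => dirDeriv (spaceDir i) V p * W p) (cylMeasure d T) :=
    ((hV.dirDeriv (spaceDir i)).continuous.mul hW.continuous).integrable_cylMeasure T
  have h2 : Integrable (fun p => V p * dirDeriv (spaceDir i) W p) (cylMeasure d T) :=
    (hV.continuous.mul (hW.dirDeriv (spaceDir i)).continuous).integrable_cylMeasure T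
  rw [e, integral_add h1 h2] at h
  linarith

lemma integral_mul_dirDeriv_timeDir_nonneg (hT : 0 ≤ T) (hW : ContDiff ℝ (⊤ : ℕ∞) W)
    (h0 : ∀ x, W (x, 0) = 0) :
    0 ≤ ∫ p, W p * dirDeriv timeDir W p ∂cylMeasure d T := by
  have hc : Continuous fun p => W p * dirDeriv timeDir W p :=
    hW.continuous.mul (hW.dirDeriv timeDir).continuous
  have hi := hc.integrable_cylMeasure T
  rw [cylMeasure] at hi ⊢
  rw [integral_prod _ hi]
  refine integral_nonneg fun x => ?_
  have hd (t : ℝ) : HasDerivAt (fun s => W (x, s) ^ 2 / 2)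
      (W (x, t) * dirDeriv timeDir W (x, t)) t := by
    refine (((hasDerivAt_time hW x t).pow 2).div_const 2).congr_deriv ?_
    push_cast
    ring
  have := intervalIntegral.integral_eq_sub_of_hasDerivAt (a := 0) (b := T) (fun t _ => hd t)
    ((hc.comp (by fun_prop : Continuous fun t : ℝ => (x, t))).intervalIntegrable 0 T)
  rw [intervalIntegral.integral_of_le hT, h0] at this
  simp only [Pi.zero_apply]
  rw [this]
  have := sq_nonneg (W (x, T))
  linarith

end Integrals

section EnergyEstimates

variable {d : ℕ} {T : ℝ} {V W : (Fin d → ℝ) × ℝ → ℝ}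

lemma integral_mul_laplacian (hV : ContDiff ℝ (⊤ : ℕ∞) V) (hW : ContDiff ℝ (⊤ : ℕ∞) W)
    (hVp : SpacePeriodic V) (hWp : SpacePeriodic W) :
    ∫ p, V p * ∑ i, dirDeriv (spaceDir i) (dirDeriv (spaceDir i) W) p ∂cylMeasure d T =
      -∫ p, ∑ i, dirDeriv (spaceDir i) V p * dirDeriv (spaceDir i) W p ∂cylMeasure d T := by
  simp only [Finset.mul_sum]
  rw [integral_finsetSum, integral_finsetSum, ← Finset.sum_neg_distrib]
  · exact Finset.sum_congr rfl fun i _ =>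
      integral_mul_dirDeriv_spaceDir hV (hW.dirDeriv _) hVp (hWp.dirDeriv _) i
  · exact fun i _ => ((hV.dirDeriv _).continuous.mul
      (hW.dirDeriv _).continuous).integrable_cylMeasure T
  · exact fun i _ => (hV.continuous.mul
      ((hW.dirDeriv _).dirDeriv _).continuous).integrable_cylMeasure T

lemma integral_laplacian_sq (hW : ContDiff ℝ (⊤ : ℕ∞) W) (hWp : SpacePeriodic W) :
    ∫ p, (∑ i, dirDeriv (spaceDir i) (dirDeriv (spaceDir i) W) p) ^ 2 ∂cylMeasure d T =
      ∫ p, ∑ i, ∑ k, dirDeriv (spaceDir i) (dirDeriv (spaceDir k) W) p ^ 2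
        ∂cylMeasure d T := by
  have h2 (v w : (Fin d → ℝ) × ℝ) : ContDiff ℝ (⊤ : ℕ∞) (dirDeriv v (dirDeriv w W)) :=
    (hW.dirDeriv w).dirDeriv v
  have hc (v w : (Fin d → ℝ) × ℝ) : Continuous (dirDeriv v (dirDeriv w W)) :=
    (h2 v w).continuous
  have hi (a b a' b' : Fin d → Fin d → (Fin d → ℝ) × ℝ) (i k : Fin d) :
      Integrable (fun p => dirDeriv (a i k) (dirDeriv (b i k) W) p *
        dirDeriv (a' i k) (dirDeriv (b' i k) W) p) (cylMeasure d T) :=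
    ((hc _ _).mul (hc _ _)).integrable_cylMeasure T
  simp only [sq, Finset.sum_mul_sum]
  rw [integral_finsetSum _ fun i _ => integrable_finsetSum _ fun k _ =>
      hi (fun i _ => spaceDir i) (fun i _ => spaceDir i) (fun _ k => spaceDir k)
        (fun _ k => spaceDir k) i k,
    integral_finsetSum _ fun i _ => integrable_finsetSum _ fun k _ =>
      hi (fun i _ => spaceDir i) (fun _ k => spaceDir k) (fun i _ => spaceDir i)
        (fun _ k => spaceDir k) i k]
  refine Finset.sum_congr rfl fun i _ => ?_
  rw [integral_finsetSum _ fun k _ => hi (fun i _ => spaceDir i) (fun i _ => spaceDir i)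
      (fun _ k => spaceDir k) (fun _ k => spaceDir k) i k,
    integral_finsetSum _ fun k _ => hi (fun i _ => spaceDir i) (fun _ k => spaceDir k)
      (fun i _ => spaceDir i) (fun _ k => spaceDir k) i k]
  refine Finset.sum_congr rfl fun k _ => ?_
  rw [integral_mul_dirDeriv_spaceDir (h2 (spaceDir i) (spaceDir i)) (hW.dirDeriv (spaceDir k))
      ((hWp.dirDeriv _).dirDeriv _) (hWp.dirDeriv _) k,
    integral_mul_dirDeriv_spaceDir (h2 (spaceDir i) (spaceDir k)) (hW.dirDeriv (spaceDir k))
      ((hWp.dirDeriv _).dirDeriv _) (hWp.dirDeriv _) i,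
    dirDeriv_comm (hW.dirDeriv (spaceDir i)) (spaceDir k) (spaceDir i),
    dirDeriv_comm hW (spaceDir k) (spaceDir i)]

lemma integral_dirDeriv_timeDir_mul_laplacian_nonpos (hT : 0 ≤ T)
    (hW : ContDiff ℝ (⊤ : ℕ∞) W) (hWp : SpacePeriodic W) (h0 : ∀ x, W (x, 0) = 0) :
    ∫ p, dirDeriv timeDir W p * ∑ i, dirDeriv (spaceDir i) (dirDeriv (spaceDir i) W) p
      ∂cylMeasure d T ≤ 0 := by
  rw [integral_mul_laplacian (hW.dirDeriv _) hW (hWp.dirDeriv _) hWp, neg_nonpos,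
    integral_finsetSum]
  · refine Finset.sum_nonneg fun i _ => ?_
    have h0i (x : Fin d → ℝ) : dirDeriv (spaceDir i) W (x, 0) = 0 := by
      rw [← congrFun (pder_slice hW i 0) x]
      simp [h0, pder]
    have h := integral_mul_dirDeriv_timeDir_nonneg hT (hW.dirDeriv (spaceDir i)) h0i
    rw [dirDeriv_comm hW] at h
    simpa only [mul_comm] using h
  · exact fun i _ => (((hW.dirDeriv _).dirDeriv _).continuous.mul
      (hW.dirDeriv _).continuous).integrable_cylMeasure T

variable {θ m K : ℝ} {f g : (Fin d → ℝ) × ℝ → ℝ}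

/-- Energy estimate for `∂ₜW = (θ/2) Δ W - f W + g` with zero initial value and `m ≤ f`. -/
lemma energy_estimate (hT : 0 ≤ T) (hm : 0 < m) (hg : Continuous g)
    (hfm : ∀ p, m ≤ f p) (hW : ContDiff ℝ (⊤ : ℕ∞) W) (hWp : SpacePeriodic W)
    (h0 : ∀ x, W (x, 0) = 0)
    (heq : ∀ p : (Fin d → ℝ) × ℝ, p.2 ∈ Set.Ioc (0 : ℝ) T → dirDeriv timeDir W p =
      θ / 2 * ∑ i, dirDeriv (spaceDir i) (dirDeriv (spaceDir i) W) p - f p * W p + g p) :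
    m ^ 2 * ∫ p, W p ^ 2 ∂cylMeasure d T
      + θ * m * ∫ p, ∑ i, dirDeriv (spaceDir i) W p ^ 2 ∂cylMeasure d T
      ≤ ∫ p, g p ^ 2 ∂cylMeasure d T := by
  have c0 : Continuous W := hW.continuous
  have c1 (v : (Fin d → ℝ) × ℝ) : Continuous (dirDeriv v W) := (hW.dirDeriv v).continuous
  have c2 (v w : (Fin d → ℝ) × ℝ) : Continuous (dirDeriv v (dirDeriv w W)) :=
    ((hW.dirDeriv w).dirDeriv v).continuous
  have hlap := integral_mul_laplacian (T := T) hW hW hWp hWp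
  have i1 : Integrable (fun p => θ * m *
      (W p * ∑ i, dirDeriv (spaceDir i) (dirDeriv (spaceDir i) W) p)) (cylMeasure d T) :=
    Continuous.integrable_cylMeasure (by fun_prop) T
  have i2 : Integrable (fun p => m ^ 2 * W p ^ 2) (cylMeasure d T) :=
    Continuous.integrable_cylMeasure (by fun_prop) T
  have i3 : Integrable (fun p => g p ^ 2) (cylMeasure d T) :=
    Continuous.integrable_cylMeasure (by fun_prop) T
  have i12 : Integrable (fun p =>
      θ * m * (W p * ∑ i, dirDeriv (spaceDir i) (dirDeriv (spaceDir i) W) p)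
        - m ^ 2 * W p ^ 2) (cylMeasure d T) := i1.sub i2
  have hle : ∫ p, 2 * m * (W p * dirDeriv timeDir W p) ∂cylMeasure d T ≤
      ∫ p, (θ * m * (W p * ∑ i, dirDeriv (spaceDir i) (dirDeriv (spaceDir i) W) p)
        - m ^ 2 * W p ^ 2 + g p ^ 2) ∂cylMeasure d T := by
    refine integral_mono_ae (Continuous.integrable_cylMeasure (by fun_prop) T)
      (i12.add i3) ?_
    filter_upwards [ae_cylMeasure_mem_Ioc d T] with p hp
    rw [heq p hp]
    have hf := mul_le_mul_of_nonneg_left (hfm p) (mul_nonneg hm.le (sq_nonneg (W p)))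
    have hsq := sq_nonneg (m * W p - g p)
    nlinarith
  have hnn := integral_mul_dirDeriv_timeDir_nonneg hT hW h0
  rw [integral_const_mul, integral_add i12 i3, integral_sub i1 i2,
    integral_const_mul, integral_const_mul, hlap] at hle
  simp only [← sq] at hle
  have := mul_nonneg (mul_nonneg zero_le_two hm.le) hnn
  linarith

/-- Maximal `L²` regularity for `∂ₜW = (θ/2) Δ W - f W + g` with zero initial value. -/
lemma maximal_regularity_estimate (hT : 0 ≤ T) (hθ : 0 ≤ θ) (hg : Continuous g)
    (hf0 : ∀ p, 0 ≤ f p) (hfK : ∀ p, f p ≤ K) (hW : ContDiff ℝ (⊤ : ℕ∞) W)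
    (hWp : SpacePeriodic W) (h0 : ∀ x, W (x, 0) = 0)
    (heq : ∀ p : (Fin d → ℝ) × ℝ, p.2 ∈ Set.Ioc (0 : ℝ) T → dirDeriv timeDir W p =
      θ / 2 * ∑ i, dirDeriv (spaceDir i) (dirDeriv (spaceDir i) W) p - f p * W p + g p) :
    ∫ p, dirDeriv timeDir W p ^ 2 ∂cylMeasure d T
      + θ ^ 2 / 4 * ∫ p, ∑ i, ∑ k, dirDeriv (spaceDir i) (dirDeriv (spaceDir k) W) p ^ 2
          ∂cylMeasure d T
      ≤ 2 * ∫ p, g p ^ 2 ∂cylMeasure d T + 2 * K ^ 2 * ∫ p, W p ^ 2 ∂cylMeasure d T := by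
  have c0 : Continuous W := hW.continuous
  have c1 (v : (Fin d → ℝ) × ℝ) : Continuous (dirDeriv v W) := (hW.dirDeriv v).continuous
  have c2 (v w : (Fin d → ℝ) × ℝ) : Continuous (dirDeriv v (dirDeriv w W)) :=
    ((hW.dirDeriv w).dirDeriv v).continuous
  have i1 : Integrable (fun p => dirDeriv timeDir W p ^ 2) (cylMeasure d T) :=
    Continuous.integrable_cylMeasure (by fun_prop) T
  have i2 : Integrable (fun p => θ ^ 2 / 4 *
      (∑ i, dirDeriv (spaceDir i) (dirDeriv (spaceDir i) W) p) ^ 2) (cylMeasure d T) :=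
    Continuous.integrable_cylMeasure (by fun_prop) T
  have i3 : Integrable (fun p => θ * (dirDeriv timeDir W p *
      ∑ i, dirDeriv (spaceDir i) (dirDeriv (spaceDir i) W) p)) (cylMeasure d T) :=
    Continuous.integrable_cylMeasure (by fun_prop) T
  have i4 : Integrable (fun p => 2 * g p ^ 2) (cylMeasure d T) :=
    Continuous.integrable_cylMeasure (by fun_prop) T
  have i5 : Integrable (fun p => 2 * K ^ 2 * W p ^ 2) (cylMeasure d T) :=
    Continuous.integrable_cylMeasure (by fun_prop) T
  have hle : ∫ p, (dirDeriv timeDir W p ^ 2 + θ ^ 2 / 4 *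
        (∑ i, dirDeriv (spaceDir i) (dirDeriv (spaceDir i) W) p) ^ 2
        - θ * (dirDeriv timeDir W p *
          ∑ i, dirDeriv (spaceDir i) (dirDeriv (spaceDir i) W) p)) ∂cylMeasure d T ≤
      ∫ p, (2 * g p ^ 2 + 2 * K ^ 2 * W p ^ 2) ∂cylMeasure d T := by
    refine integral_mono_ae ((i1.fun_add i2).sub i3) (i4.fun_add i5) ?_
    filter_upwards [ae_cylMeasure_mem_Ioc d T] with p hp
    rw [heq p hp]
    have hf : f p ^ 2 * W p ^ 2 ≤ K ^ 2 * W p ^ 2 :=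
      mul_le_mul_of_nonneg_right (pow_le_pow_left₀ (hf0 p) (hfK p) 2) (sq_nonneg _)
    have hsq := sq_nonneg (g p + f p * W p)
    nlinarith
  have hnp := mul_nonpos_of_nonneg_of_nonpos hθ
    (integral_dirDeriv_timeDir_mul_laplacian_nonpos hT hW hWp h0)
  rw [integral_sub (i1.fun_add i2) i3, integral_add i1 i2, integral_add i4 i5,
    integral_const_mul, integral_const_mul, integral_const_mul, integral_const_mul,
    integral_laplacian_sq hW hWp] at hle
  linarith

end EnergyEstimates

section Norms

variable {d : ℕ} {T : ℝ} {W : (Fin d → ℝ) × ℝ → ℝ}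

lemma h21Sq_le (hW : ContDiff ℝ (⊤ : ℕ∞) W) :
    h21Sq T (fun x t => W (x, t)) ≤
      ((Finset.univ.filter (fun j : Fin d → Fin 3 => (∑ i, (j i : ℕ)) ≤ 2)).card : ℝ) *
        (∫ p, W p ^ 2 ∂cylMeasure d T
          + ∫ p, ∑ i, dirDeriv (spaceDir i) W p ^ 2 ∂cylMeasure d T
          + ∫ p, ∑ i, ∑ k, dirDeriv (spaceDir i) (dirDeriv (spaceDir k) W) p ^ 2
              ∂cylMeasure d T)
      + (∫ p, W p ^ 2 ∂cylMeasure d T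
          + ∫ p, dirDeriv timeDir W p ^ 2 ∂cylMeasure d T) := by
  have c0 : Continuous W := hW.continuous
  have c1 (v : (Fin d → ℝ) × ℝ) : Continuous (dirDeriv v W) := (hW.dirDeriv v).continuous
  have c2 (v w : (Fin d → ℝ) × ℝ) : Continuous (dirDeriv v (dirDeriv w W)) :=
    ((hW.dirDeriv w).dirDeriv v).continuous
  have cm (j : Fin d → ℕ) :
      Continuous fun p : (Fin d → ℝ) × ℝ => mder j (fun y => W (y, p.2)) p.1 ^ 2 :=
    (continuous_mder_slice hW j).pow 2
  have i0 : Integrable (fun p => W p ^ 2) (cylMeasure d T) :=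
    Continuous.integrable_cylMeasure (by fun_prop) T
  have i1 : Integrable (fun p => ∑ i, dirDeriv (spaceDir i) W p ^ 2) (cylMeasure d T) :=
    Continuous.integrable_cylMeasure (by fun_prop) T
  have i2 : Integrable (fun p => ∑ i, ∑ k,
      dirDeriv (spaceDir i) (dirDeriv (spaceDir k) W) p ^ 2) (cylMeasure d T) :=
    Continuous.integrable_cylMeasure (by fun_prop) T
  have it : Integrable (fun p => dirDeriv timeDir W p ^ 2) (cylMeasure d T) :=
    Continuous.integrable_cylMeasure (by fun_prop) T
  refine add_le_add ?_ (le_of_eq ?_)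
  · have hswap (t : ℝ) :
        ∑ j ∈ Finset.univ.filter (fun j : Fin d → Fin 3 => (∑ i, (j i : ℕ)) ≤ 2),
          ∫ x in unitCube d, (mder (fun i => (j i : ℕ)) (fun y => W (y, t)) x) ^ 2 =
        ∫ x in unitCube d,
          ∑ j ∈ Finset.univ.filter (fun j : Fin d → Fin 3 => (∑ i, (j i : ℕ)) ≤ 2),
            (mder (fun i => (j i : ℕ)) (fun y => W (y, t)) x) ^ 2 := by
      refine (integral_finsetSum _ fun j _ => ?_).symm
      have : Continuous fun x => (mder (fun i => (j i : ℕ)) (fun y => W (y, t)) x) ^ 2 :=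
        (cm fun i => j i).comp (by fun_prop : Continuous fun x : Fin d → ℝ => (x, t))
      exact this.continuousOn.integrableOn_compact isCompact_Icc
    have hi := (continuous_finsetSum
      (Finset.univ.filter fun j : Fin d → Fin 3 => (∑ i, (j i : ℕ)) ≤ 2)
      fun j _ => cm fun i => j i).integrable_cylMeasure T
    simp only [hswap]
    rw [← integral_add i0 i1, ← integral_add (i0.fun_add i1) i2, ← integral_const_mul]
    have hi' := hi
    rw [cylMeasure] at hi
    refine (integral_prod_symm _ hi).symm.trans_le ?_
    refine integral_mono hi' (((i0.fun_add i1).fun_add i2).const_mul _) fun p => ?_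
    rw [← nsmul_eq_mul]
    exact Finset.sum_le_card_nsmul _ _ _ fun j hj =>
      mder_slice_sq_le hW (Finset.mem_filter.mp hj).2 p.1 p.2
  · have ht (x : Fin d → ℝ) (t : ℝ) :
        deriv (fun s => W (x, s)) t = dirDeriv timeDir W (x, t) := (hasDerivAt_time hW x t).deriv
    rw [← integral_add i0 it]
    simp only [ht]
    have hi := i0.fun_add it
    rw [cylMeasure] at hi
    exact (integral_prod _ hi).symm

lemma integral_cylMeasure_sq_fst (hT : 0 ≤ T) {h : (Fin d → ℝ) → ℝ} :
    ∫ p, h p.1 ^ 2 ∂cylMeasure d T = T * l2T h ^ 2 := by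
  have := integral_fun_fst (μ := volume.restrict (unitCube d))
    (ν := volume.restrict (Set.Ioc (0 : ℝ) T)) fun x => h x ^ 2
  rw [cylMeasure, this, l2T, Real.sq_sqrt (integral_nonneg fun x => sq_nonneg _)]
  simp [measureReal_def, hT]

lemma abs_le_supT {F : (Fin d → ℝ) → ℝ} (hF : ∃ M, ∀ x, |F x| ≤ M) (x : Fin d → ℝ) :
    |F x| ≤ supT F := by
  obtain ⟨M, hM⟩ := hF
  exact le_ciSup (f := fun x => |F x|) ⟨M, by rintro _ ⟨y, rfl⟩; exact hM y⟩ x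

lemma abs_le_supQ {u : (Fin d → ℝ) → ℝ → ℝ} (hu : SmoothQ u) (hper : ZPerSpace u)
    (x : Fin d → ℝ) {t : ℝ} (ht : t ∈ Set.Icc (0 : ℝ) T) : |u x t| ≤ supQ T u := by
  obtain ⟨M, hM⟩ := ((isCompact_Icc (a := (0 : Fin d → ℝ)) (b := 1)).prod
    (isCompact_Icc (a := (0 : ℝ)) (b := T))).exists_bound_of_continuousOn
      hu.continuous.continuousOn
  have hbd (y : Fin d → ℝ) (s : ℝ) (hs : s ∈ Set.Icc (0 : ℝ) T) : |u y s| ≤ M := by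
    have h := hM (fun i => Int.fract (y i), s)
      ⟨⟨fun i => Int.fract_nonneg _, fun i => (Int.fract_lt_one _).le⟩, hs⟩
    have hp := hper s (fun i => Int.fract (y i)) fun i => ⌊y i⌋
    simp only [Int.fract_add_floor] at hp
    rw [hp]
    exact h
  have hM0 : 0 ≤ M := (abs_nonneg _).trans (hbd x t ht)
  have hin (y : Fin d → ℝ) (s : ℝ) : ⨆ _ : s ∈ Set.Icc (0 : ℝ) T, |u y s| ≤ M :=
    Real.iSup_le (fun hs => hbd y s hs) hM0
  calc |u x t| = ⨆ _ : t ∈ Set.Icc (0 : ℝ) T, |u x t| := by rw [ciSup_pos ht]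
    _ ≤ ⨆ s, ⨆ _ : s ∈ Set.Icc (0 : ℝ) T, |u x s| :=
      le_ciSup (f := fun s => ⨆ _ : s ∈ Set.Icc (0 : ℝ) T, |u x s|)
        ⟨M, by rintro _ ⟨s, rfl⟩; exact hin x s⟩ t
    _ ≤ supQ T u :=
      le_ciSup (f := fun y => ⨆ s, ⨆ _ : s ∈ Set.Icc (0 : ℝ) T, |u y s|)
        ⟨M, by rintro _ ⟨y, rfl⟩; exact Real.iSup_le (hin y) hM0⟩ x

end Norms

lemma LinkFun.exists_deriv_bound (Φ : LinkFun) :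
    ∃ C, 0 ≤ C ∧ (∀ x, |deriv Φ.toFun x| ≤ C) ∧ ∀ x, Φ.toFun x ≤ Φ.toFun 0 + C * |x| := by
  obtain ⟨C, hC⟩ := Φ.derivs_bdd 1 le_rfl
  rw [iteratedDeriv_one] at hC
  refine ⟨C, (abs_nonneg _).trans (hC 0), hC, fun x => ?_⟩
  have h := convex_univ.norm_image_sub_le_of_norm_deriv_le
    (fun y _ => Φ.smooth.differentiable (by simp) y) (fun y _ => hC y)
    (Set.mem_univ 0) (Set.mem_univ x)
  rw [sub_zero, Real.norm_eq_abs, Real.norm_eq_abs] at h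
  linarith [le_abs_self (Φ.toFun x - Φ.toFun 0)]

/-- parabolic regularity bound for the linearization `I_{θ,F} h`
(Lemma `bounds`, item (vii)). -/
theorem linearization_regularity_bound {d : ℕ} (hd : 1 ≤ d) (T θmin θmax : ℝ)
    (hT : 0 < T) (hθmin : 0 < θmin) (hθ : θmin ≤ θmax) (Φ : LinkFun)
    (u0 : (Fin d → ℝ) → ℝ) (hu0 : ContDiff ℝ (⊤ : ℕ∞) u0) (hu0per : ZPer u0) :
    ∃ D > (0 : ℝ), ∀ θ ∈ Set.Icc θmin θmax,
      ∀ F h : (Fin d → ℝ) → ℝ,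
      Continuous F → ZPer F → (∃ M, ∀ x, |F x| ≤ M) →
      Continuous h → ZPer h → (∃ M, ∀ x, |h x| ≤ M) →
      ∀ u z : (Fin d → ℝ) → ℝ → ℝ,
        HeatSol T θ (fun x => Φ.toFun (F x)) u0 u →
        LinSol T θ Φ F h u z →
        h21 T z ≤ D * (1 + supT F) * l2T h * supQ T u := by
  obtain ⟨C, hC0, hC, hlin⟩ := Φ.exists_deriv_bound
  set m := Φ.fmin
  have hm : 0 < m := Φ.fmin_pos
  set A := Φ.toFun 0 + C
  set N : ℝ :=
    ((Finset.univ.filter (fun j : Fin d → Fin 3 => (∑ i, (j i : ℕ)) ≤ 2)).card : ℝ)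
  have hN : 0 ≤ N := Nat.cast_nonneg _
  set B := 2 + 2 * A ^ 2 / m ^ 2
  set E := N * (1 / m ^ 2 + 1 / (θmin * m) + 4 / θmin ^ 2 * B) + (1 / m ^ 2 + B)
  refine ⟨√(C ^ 2 * T * E) + 1, by positivity, ?_⟩
  intro θ hθI F h hFc _ hFb hhc _ _ u z hu hz
  obtain ⟨hus, hup, -, -⟩ := hu
  obtain ⟨hzs, hzp, hzeq, hz0⟩ := hz
  set S := supT F
  set U := supQ T u
  have hS : 0 ≤ S := (abs_nonneg _).trans (abs_le_supT hFb 0)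
  have hU : 0 ≤ U := (abs_nonneg _).trans (abs_le_supQ hus hup 0 ⟨le_rfl, hT.le⟩)
  have hθ0 : 0 < θ := hθmin.trans_le hθI.1
  have hΦ0 : 0 < Φ.toFun 0 := hm.trans (Φ.gt_fmin 0)
  set W : (Fin d → ℝ) × ℝ → ℝ := fun p => z p.1 p.2
  have hW : ContDiff ℝ (⊤ : ℕ∞) W := hzs
  have hWp : SpacePeriodic W := fun p k => by
    simpa [W, Pi.add_def] using hzp p.2 p.1 k
  set f : (Fin d → ℝ) × ℝ → ℝ := fun p => Φ.toFun (F p.1)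
  set g : (Fin d → ℝ) × ℝ → ℝ := fun p => h p.1 * deriv Φ.toFun (F p.1) * u p.1 p.2
  have hfm (p) : m ≤ f p := (Φ.gt_fmin _).le
  have hfK (p) : f p ≤ Φ.toFun 0 + C * S :=
    (hlin _).trans (by gcongr; exact abs_le_supT hFb p.1)
  have hg : Continuous g := by
    have h1 : Continuous (deriv Φ.toFun) := Φ.smooth.continuous_deriv (by simp)
    have h2 : Continuous fun p : (Fin d → ℝ) × ℝ => u p.1 p.2 := hus.continuous
    fun_prop
  have heq (p : (Fin d → ℝ) × ℝ) (hp : p.2 ∈ Set.Ioc (0 : ℝ) T) : dirDeriv timeDir W p =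
      θ / 2 * ∑ i, dirDeriv (spaceDir i) (dirDeriv (spaceDir i) W) p - f p * W p + g p := by
    rw [← lap_slice hW p.1 p.2, ← (hasDerivAt_time hW p.1 p.2).deriv]
    exact hzeq p.1 p.2 hp
  have hen := energy_estimate hT.le hm hg hfm hW hWp hz0 heq
  have hmax := maximal_regularity_estimate hT.le hθ0.le hg (fun p => hm.le.trans (hfm p)) hfK
    hW hWp hz0 heq
  have hG : ∫ p, g p ^ 2 ∂cylMeasure d T ≤ C ^ 2 * U ^ 2 * (T * l2T h ^ 2) := by
    rw [← integral_cylMeasure_sq_fst hT.le, ← integral_const_mul]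
    refine integral_mono_ae (Continuous.integrable_cylMeasure (by fun_prop) T)
      (Continuous.integrable_cylMeasure (by fun_prop) T) ?_
    filter_upwards [ae_cylMeasure_mem_Ioc d T] with p hp
    have h1 : deriv Φ.toFun (F p.1) ^ 2 ≤ C ^ 2 :=
      sq_le_sq' (neg_le_of_abs_le (hC _)) (le_of_abs_le (hC _))
    have h2 : u p.1 p.2 ^ 2 ≤ U ^ 2 := by
      have := abs_le_supQ hus hup p.1 (Set.Ioc_subset_Icc_self hp)
      exact sq_le_sq' (neg_le_of_abs_le this) (le_of_abs_le this)
    calc g p ^ 2 = deriv Φ.toFun (F p.1) ^ 2 * u p.1 p.2 ^ 2 * h p.1 ^ 2 := by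
          simp only [g]; ring
      _ ≤ C ^ 2 * U ^ 2 * h p.1 ^ 2 := by gcongr
  have hnorm : h21Sq T z ≤ _ := h21Sq_le hW
  have hZ0 : 0 ≤ ∫ p, W p ^ 2 ∂cylMeasure d T := integral_nonneg fun p => sq_nonneg _
  have hP0 : 0 ≤ ∫ p, dirDeriv timeDir W p ^ 2 ∂cylMeasure d T :=
    integral_nonneg fun p => sq_nonneg _
  have hS1 : 0 ≤ ∫ p, ∑ i, dirDeriv (spaceDir i) W p ^ 2 ∂cylMeasure d T :=
    integral_nonneg fun p => Finset.sum_nonneg fun i _ => sq_nonneg _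
  have hS2 : 0 ≤ ∫ p, ∑ i, ∑ k, dirDeriv (spaceDir i) (dirDeriv (spaceDir k) W) p ^ 2
      ∂cylMeasure d T :=
    integral_nonneg fun p => Finset.sum_nonneg fun i _ => Finset.sum_nonneg fun k _ =>
      sq_nonneg _
  have hG0 : 0 ≤ ∫ p, g p ^ 2 ∂cylMeasure d T := integral_nonneg fun p => sq_nonneg _
  change h21Sq T z ≤ N * _ + _ at hnorm
  generalize (∫ p, g p ^ 2 ∂cylMeasure d T) = G at *
  generalize (∫ p, W p ^ 2 ∂cylMeasure d T) = Z at *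
  generalize (∫ p, dirDeriv timeDir W p ^ 2 ∂cylMeasure d T) = P at *
  generalize (∫ p, ∑ i, dirDeriv (spaceDir i) W p ^ 2 ∂cylMeasure d T) = S₁ at *
  generalize (∫ p, ∑ i, ∑ k, dirDeriv (spaceDir i) (dirDeriv (spaceDir k) W) p ^ 2
    ∂cylMeasure d T) = S₂ at *
  set R := (1 + S) ^ 2
  have hR : 1 ≤ R := one_le_pow₀ (by linarith)
  have hGR : G ≤ G * R := le_mul_of_one_le_right hG0 hR
  have hZ : Z ≤ 1 / m ^ 2 * G := by
    rw [one_div, ← div_eq_inv_mul, le_div_iff₀ (by positivity)]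
    linarith [mul_nonneg (mul_nonneg hθ0.le hm.le) hS1]
  have hS₁ : S₁ ≤ 1 / (θmin * m) * G := by
    rw [one_div, ← div_eq_inv_mul, le_div_iff₀ (by positivity)]
    have := mul_le_mul_of_nonneg_right (mul_le_mul_of_nonneg_right hθI.1 hm.le) hS1
    linarith [mul_nonneg (sq_nonneg m) hZ0]
  have hK : (Φ.toFun 0 + C * S) ^ 2 ≤ A ^ 2 * R := by
    rw [← mul_pow]
    refine pow_le_pow_left₀ (by positivity) ?_ 2
    simp only [A]
    linarith [mul_nonneg hΦ0.le hS]
  have hBG : 2 * G + 2 * (Φ.toFun 0 + C * S) ^ 2 * Z ≤ B * (G * R) := by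
    calc 2 * G + 2 * (Φ.toFun 0 + C * S) ^ 2 * Z
        ≤ 2 * (G * R) + 2 * (A ^ 2 * R) * (1 / m ^ 2 * G) := by gcongr
      _ = B * (G * R) := by simp only [B]; ring
  have hPB : P ≤ B * (G * R) := by linarith [mul_nonneg (sq_nonneg θ) hS2]
  have hS₂ : S₂ ≤ 4 / θmin ^ 2 * (B * (G * R)) := by
    have h1 : θmin ^ 2 * S₂ ≤ θ ^ 2 * S₂ :=
      mul_le_mul_of_nonneg_right (pow_le_pow_left₀ hθmin.le hθI.1 2) hS2
    rw [div_mul_eq_mul_div, le_div_iff₀ (by positivity)]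
    linarith
  have hZ' : Z ≤ 1 / m ^ 2 * (G * R) := hZ.trans (by gcongr)
  have hS₁' : S₁ ≤ 1 / (θmin * m) * (G * R) := hS₁.trans (by gcongr)
  have hE0 : 0 ≤ E := by positivity
  have hfin : h21Sq T z ≤ C ^ 2 * T * E * ((1 + S) * l2T h * U) ^ 2 := by
    calc h21Sq T z ≤ N * (Z + S₁ + S₂) + (Z + P) := hnorm
      _ ≤ N * (1 / m ^ 2 * (G * R) + 1 / (θmin * m) * (G * R)
            + 4 / θmin ^ 2 * (B * (G * R))) + (1 / m ^ 2 * (G * R) + B * (G * R)) := by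
          gcongr
      _ = E * R * G := by simp only [E]; ring
      _ ≤ E * R * (C ^ 2 * U ^ 2 * (T * l2T h ^ 2)) := by gcongr
      _ = C ^ 2 * T * E * ((1 + S) * l2T h * U) ^ 2 := by simp only [R]; ring
  have hX : 0 ≤ (1 + S) * l2T h * U :=
    mul_nonneg (mul_nonneg (by linarith) (Real.sqrt_nonneg _)) hU
  calc h21 T z ≤ √(C ^ 2 * T * E * ((1 + S) * l2T h * U) ^ 2) := Real.sqrt_le_sqrt hfin
    _ = √(C ^ 2 * T * E) * ((1 + S) * l2T h * U) := by
      rw [Real.sqrt_mul (by positivity), Real.sqrt_sq hX]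
    _ ≤ (√(C ^ 2 * T * E) + 1) * ((1 + S) * l2T h * U) := by gcongr; linarith
    _ = (√(C ^ 2 * T * E) + 1) * (1 + S) * l2T h * U := by ring
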